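/- arXiv:1901.04127 — 2 statements merged into one kernel-verified Lean document; each statement's English description precedes it below -/
import Mathlib

section
/- Let p ∈ (0,1) and let {X_n, n≥1} be a φ-mixing sequence of random variables with Σ_{n=1}^∞ φ^{1/2}(n) < ∞. Assume the common marginal distribution function F is differentiable at ξ_p with F′(ξ_p) = f(ξ_p) > 0, and that f′(x) is bounded in a neighborhood of ξ_p. Then for any δ > 0, with probability 1, |ξ_{p,n} − ξ_p| ≤ (2√C_3 + δ)(log n)^{1/2} / (f(ξ_p) n^{1/2}) for all n sufficiently large, where C_3 = 4[1 + 4 Σ_{n=1}^∞ φ^{1/2}(n)]. -/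
open MeasureTheory Filter Set

/-- The σ-algebra generated by the random variables `X i` for `i ∈ S`. -/
noncomputable def sigmaGen {Ω : Type*} (X : ℕ → Ω → ℝ) (S : Set ℕ) : MeasurableSpace Ω :=
  ⨆ i ∈ S, MeasurableSpace.comap (X i) inferInstance

/-- The φ-mixing coefficients of the sequence `X` with respect to the measure `μ`:
`φ(n) = sup_{k ≥ 1} sup { |P(B|A) - P(B)| : A ∈ σ(X_i, 1 ≤ i ≤ k), P(A) > 0,
B ∈ σ(X_i, i ≥ k + n) }`. -/
noncomputable def phiCoef {Ω : Type*} [MeasurableSpace Ω] (X : ℕ → Ω → ℝ)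
    (μ : Measure Ω) (n : ℕ) : ℝ :=
  sSup {r : ℝ | ∃ k : ℕ, 1 ≤ k ∧ ∃ A B : Set Ω,
    MeasurableSet[sigmaGen X {i | 1 ≤ i ∧ i ≤ k}] A ∧
    MeasurableSet[sigmaGen X {i | k + n ≤ i}] B ∧
    0 < μ A ∧
    r = |(μ (A ∩ B)).toReal / (μ A).toReal - (μ B).toReal|}

/-- The empirical distribution function `F_n(x) = n⁻¹ ∑_{i=1}^n I(X_i ≤ x)`. -/
noncomputable def empDF {Ω : Type*} (X : ℕ → Ω → ℝ) (n : ℕ) (ω : Ω) (x : ℝ) : ℝ :=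
  (n : ℝ)⁻¹ * ∑ i ∈ Finset.Icc 1 n, (if X i ω ≤ x then (1 : ℝ) else 0)

/-- The `p`-th quantile `F⁻¹(p) = inf {x : F(x) ≥ p}` of a distribution function `F`. -/
noncomputable def quantile (F : ℝ → ℝ) (p : ℝ) : ℝ :=
  sInf {x : ℝ | p ≤ F x}

/-- The sample `p`-th quantile `ξ_{p,n} = F_n⁻¹(p) = inf {x : F_n(x) ≥ p}`. -/
noncomputable def sampleQuantile {Ω : Type*} (X : ℕ → Ω → ℝ) (n : ℕ) (ω : Ω) (p : ℝ) : ℝ :=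
  sInf {x : ℝ | p ≤ empDF X n ω x}

lemma eventually_exists_block_length :
    ∀ᶠ n : ℕ in atTop, ∃ m : ℕ, 1 ≤ m ∧ n ≤ m ^ 3 ∧ 4 * (m : ℝ) ^ 2 * Real.log n ≤ n := by
  have hlo := ((isLittleO_log_rpow_atTop (show (0 : ℝ) < 1 / 3 by norm_num)).def
    (show (0 : ℝ) < 1 / 16 by norm_num)).natCast_atTop
  filter_upwards [hlo, eventually_ge_atTop 1] with n hn hn1
  have hn1R : (1 : ℝ) ≤ n := by exact_mod_cast hn1
  set r : ℝ := (n : ℝ) ^ ((1 : ℝ) / 3) with hr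
  have hr1 : 1 ≤ r := Real.one_le_rpow hn1R (by norm_num)
  have hr3 : r ^ 3 = n := by
    rw [hr, ← Real.rpow_natCast, ← Real.rpow_mul (by positivity)]; norm_num
  have hlog : 0 ≤ Real.log n := Real.log_nonneg hn1R
  rw [Real.norm_of_nonneg hlog, Real.norm_of_nonneg (by positivity)] at hn
  have hle : r ≤ ⌈r⌉₊ := Nat.le_ceil r
  have hlt : (⌈r⌉₊ : ℝ) < r + 1 := Nat.ceil_lt_add_one (by positivity)
  refine ⟨⌈r⌉₊, Nat.one_le_ceil_iff.2 (by positivity), ?_, ?_⟩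
  · have : (n : ℝ) ≤ (⌈r⌉₊ : ℝ) ^ 3 := hr3 ▸ pow_le_pow_left₀ (by positivity) hle 3
    exact_mod_cast this
  · calc 4 * (⌈r⌉₊ : ℝ) ^ 2 * Real.log n ≤ 4 * (2 * r) ^ 2 * (1 / 16 * r) := by
          gcongr; linarith
      _ = (n : ℝ) := by rw [← hr3]; ring

lemma comap_le_sigmaGen {Ω : Type*} {X : ℕ → Ω → ℝ} {S : Set ℕ} {i : ℕ} (hi : i ∈ S) :
    MeasurableSpace.comap (X i) inferInstance ≤ sigmaGen X S :=
  le_iSup₂ (f := fun i (_ : i ∈ S) => MeasurableSpace.comap (X i) inferInstance) i hi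

lemma sum_range_two_mul_blocks {M : Type*} [AddCommMonoid M] (g : ℕ → M) (m K : ℕ) :
    ∑ i ∈ Finset.range (2 * m * K), g i =
      ∑ j ∈ Finset.range K, ∑ i ∈ Finset.range m, g (2 * m * j + i) +
        ∑ j ∈ Finset.range K, ∑ i ∈ Finset.range m, g (m + 2 * m * j + i) := by
  induction K with
  | zero => simp
  | succ K ih =>
    rw [show 2 * m * (K + 1) = 2 * m * K + m + m by ring, Finset.sum_range_add,
      Finset.sum_range_add, ih, Finset.sum_range_succ, Finset.sum_range_succ,
      add_assoc, add_add_add_comm]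
    simp [add_comm m]

lemma measurable_block_sum {Ω : Type*} {X : ℕ → Ω → ℝ} {Y : ℕ → Ω → ℝ}
    (hY : ∀ i, Measurable[MeasurableSpace.comap (X i) inferInstance] (Y i)) {S : Set ℕ} {a m : ℕ}
    (hS : ∀ i < m, a + i ∈ S) :
    Measurable[sigmaGen X S] fun ω => ∑ i ∈ Finset.range m, Y (a + i) ω :=
  Finset.measurable_fun_sum _ fun i hi =>
    (hY _).mono (comap_le_sigmaGen (hS i (Finset.mem_range.1 hi))) le_rfl

lemma abs_block_sum_le {Ω : Type*} {Y : ℕ → Ω → ℝ} (hb : ∀ i ω, |Y i ω| ≤ 1) (a m : ℕ) (ω : Ω) :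
    |∑ i ∈ Finset.range m, Y (a + i) ω| ≤ m := by
  refine (Finset.abs_sum_le_sum_abs _ _).trans ?_
  simpa using Finset.sum_le_sum (s := Finset.range m) fun i _ => hb (a + i) ω

section PhiMixing

variable {Ω : Type*} [mΩ : MeasurableSpace Ω] {μ : Measure Ω} {X : ℕ → Ω → ℝ}

lemma sigmaGen_le (hX : ∀ i, Measurable (X i)) (S : Set ℕ) : sigmaGen X S ≤ mΩ :=
  iSup₂_le fun i _ => (hX i).comap_le

lemma abs_condProb_sub_le_one [IsProbabilityMeasure μ] (A B : Set Ω) :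
    |(μ (A ∩ B)).toReal / (μ A).toReal - (μ B).toReal| ≤ 1 := by
  have hB0 : 0 ≤ (μ B).toReal := ENNReal.toReal_nonneg
  have hB1 : (μ B).toReal ≤ 1 := measureReal_le_one
  have hA0 : 0 ≤ (μ (A ∩ B)).toReal / (μ A).toReal := by positivity
  have hA1 : (μ (A ∩ B)).toReal / (μ A).toReal ≤ 1 :=
    div_le_one_of_le₀ (measureReal_mono inter_subset_left) ENNReal.toReal_nonneg
  rw [abs_le]; constructor <;> linarith

lemma phiCoef_nonneg (n : ℕ) : 0 ≤ phiCoef X μ n := by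
  refine Real.sSup_nonneg ?_
  rintro r ⟨k, -, A, B, -, -, -, rfl⟩
  exact abs_nonneg _

lemma phiCoef_le_one [IsProbabilityMeasure μ] (n : ℕ) : phiCoef X μ n ≤ 1 := by
  refine Real.sSup_le ?_ zero_le_one
  rintro r ⟨k, -, A, B, -, -, -, rfl⟩
  exact abs_condProb_sub_le_one A B

lemma phiCoef_le_sqrt [IsProbabilityMeasure μ] (n : ℕ) :
    phiCoef X μ n ≤ Real.sqrt (phiCoef X μ n) := by
  refine Real.le_sqrt_of_sq_le ?_
  nlinarith [phiCoef_nonneg (X := X) (μ := μ) n, phiCoef_le_one (X := X) (μ := μ) n]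

lemma measureReal_inter_le_phiCoef [IsProbabilityMeasure μ] {k n : ℕ} {A B : Set Ω}
    (hA : MeasurableSet[sigmaGen X {i | 1 ≤ i ∧ i ≤ k}] A)
    (hB : MeasurableSet[sigmaGen X {i | k + n ≤ i}] B) :
    μ.real (A ∩ B) ≤ μ.real A * (μ.real B + phiCoef X μ n) := by
  have hφ := phiCoef_nonneg (X := X) (μ := μ) n
  rcases eq_or_ne (μ A) 0 with h0 | h0
  · have h1 : μ.real A = 0 := by simp [Measure.real, h0]
    have h2 : μ.real (A ∩ B) = 0 := by
      simp [Measure.real, measure_mono_null inter_subset_left h0]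
    rw [h1, h2, zero_mul]
  rcases Nat.eq_zero_or_pos k with rfl | hk
  · have hbot : sigmaGen X {i | 1 ≤ i ∧ i ≤ 0} = ⊥ := by
      refine eq_bot_iff.2 (iSup₂_le fun i hi => ?_)
      have h1 : 1 ≤ i := hi.1
      have h2 : i ≤ 0 := hi.2
      omega
    rw [hbot, MeasurableSpace.measurableSet_bot_iff] at hA
    rcases hA with rfl | rfl
    · simp at h0
    · simp [hφ]
  · have hpos : 0 < μ.real A := ENNReal.toReal_pos h0 (measure_ne_top _ _)
    have hle : |μ.real (A ∩ B) / μ.real A - μ.real B| ≤ phiCoef X μ n := by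
      refine le_csSup ⟨1, ?_⟩ ⟨k, hk, A, B, hA, hB, pos_iff_ne_zero.2 h0, rfl⟩
      rintro r ⟨k, -, A, B, -, -, -, rfl⟩
      exact abs_condProb_sub_le_one A B
    have h1 : μ.real (A ∩ B) / μ.real A ≤ μ.real B + phiCoef X μ n := by
      linarith [le_abs_self (μ.real (A ∩ B) / μ.real A - μ.real B)]
    rw [div_le_iff₀ hpos] at h1
    linarith

lemma setIntegral_le_phiCoef [IsProbabilityMeasure μ] (hX : ∀ i, Measurable (X i)) {k n : ℕ}
    {A : Set Ω} {W : Ω → ℝ} {b : ℝ}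
    (hA : MeasurableSet[sigmaGen X {i | 1 ≤ i ∧ i ≤ k}] A)
    (hW : Measurable[sigmaGen X {i | k + n ≤ i}] W) (hW0 : ∀ ω, 0 ≤ W ω) (hWb : ∀ ω, W ω ≤ b) :
    ∫ ω in A, W ω ∂μ ≤ μ.real A * (∫ ω, W ω ∂μ + b * phiCoef X μ n) := by
  have hWm : Measurable W := hW.mono (sigmaGen_le hX _) le_rfl
  have hInt : Integrable W μ :=
    Integrable.of_bound hWm.aestronglyMeasurable b
      (ae_of_all _ fun ω => by rw [Real.norm_of_nonneg (hW0 ω)]; exact hWb ω)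
  have hb : 0 ≤ b := by
    have : Nonempty Ω := nonempty_of_isProbabilityMeasure μ
    exact (hW0 (Classical.arbitrary Ω)).trans (hWb _)
  have hlevel : ∀ (ν : Measure Ω) [IsFiniteMeasure ν],
      IntegrableOn (fun t => ν.real {a | t ≤ W a}) (Ioc 0 b) := fun ν _ => by
    refine IntegrableOn.mono_set (t := Icc 0 b) ?_ Ioc_subset_Icc_self
    refine AntitoneOn.integrableOn_isCompact isCompact_Icc ?_
    intro s _ t _ hst
    exact measureReal_mono fun a (ha : t ≤ W a) => hst.trans ha
  rw [hInt.integral_eq_integral_Ioc_meas_le (ae_of_all _ hW0) (ae_of_all _ hWb),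
    hInt.integrableOn.integral_eq_integral_Ioc_meas_le (ae_of_all _ hW0) (ae_of_all _ hWb)]
  calc ∫ t in Ioc 0 b, (μ.restrict A).real {a | t ≤ W a}
      ≤ ∫ t in Ioc 0 b, μ.real A * (μ.real {a | t ≤ W a} + phiCoef X μ n) := by
        refine setIntegral_mono (hlevel _) (((hlevel μ).add (by simp)).const_mul _) fun t => ?_
        have hm : MeasurableSet[sigmaGen X {i | k + n ≤ i}] {a | t ≤ W a} :=
          hW measurableSet_Ici
        have := measureReal_inter_le_phiCoef (μ := μ) hA hm
        rwa [measureReal_restrict_apply (sigmaGen_le hX _ _ hm), inter_comm]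
    _ = _ := by
        rw [integral_const_mul, integral_add (hlevel μ) (by simp)]
        simp [hb]

lemma integral_mul_le_phiCoef [IsProbabilityMeasure μ] (hX : ∀ i, Measurable (X i)) {k n : ℕ}
    {Z W : Ω → ℝ} {b c : ℝ}
    (hZ : Measurable[sigmaGen X {i | 1 ≤ i ∧ i ≤ k}] Z) (hZ0 : ∀ ω, 0 ≤ Z ω) (hZc : ∀ ω, Z ω ≤ c)
    (hW : Measurable[sigmaGen X {i | k + n ≤ i}] W) (hW0 : ∀ ω, 0 ≤ W ω) (hWb : ∀ ω, W ω ≤ b) :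
    ∫ ω, Z ω * W ω ∂μ ≤ (∫ ω, Z ω ∂μ) * (∫ ω, W ω ∂μ + b * phiCoef X μ n) := by
  have hm := sigmaGen_le hX {i | 1 ≤ i ∧ i ≤ k}
  have hWm : Measurable W := hW.mono (sigmaGen_le hX _) le_rfl
  have hZm : Measurable Z := hZ.mono hm le_rfl
  have hWi : Integrable W μ :=
    Integrable.of_bound hWm.aestronglyMeasurable b
      (ae_of_all _ fun ω => by rw [Real.norm_of_nonneg (hW0 ω)]; exact hWb ω)
  have hZi : Integrable Z μ :=
    Integrable.of_bound hZm.aestronglyMeasurable c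
      (ae_of_all _ fun ω => by rw [Real.norm_of_nonneg (hZ0 ω)]; exact hZc ω)
  have hb : 0 ≤ b := by
    have : Nonempty Ω := nonempty_of_isProbabilityMeasure μ
    exact (hW0 (Classical.arbitrary Ω)).trans (hWb _)
  set d : ℝ := ∫ ω, W ω ∂μ + b * phiCoef X μ n with hd
  have hd0 : 0 ≤ d :=
    add_nonneg (integral_nonneg hW0) (mul_nonneg hb (phiCoef_nonneg n))
  have hmeas : (μ.withDensity fun ω => ENNReal.ofReal (W ω)).trim hm ≤
      ENNReal.ofReal d • μ.trim hm := by
    refine Measure.le_iff.2 fun A hA => ?_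
    rw [trim_measurableSet_eq hm hA, withDensity_apply _ (hm _ hA), Measure.smul_apply,
      trim_measurableSet_eq hm hA, smul_eq_mul,
      ← ofReal_integral_eq_lintegral_ofReal hWi.integrableOn (ae_of_all _ hW0),
      ← ofReal_measureReal, ← ENNReal.ofReal_mul hd0, mul_comm d]
    exact ENNReal.ofReal_le_ofReal (setIntegral_le_phiCoef hX hA hW hW0 hWb)
  have key : ∫⁻ ω, ENNReal.ofReal (Z ω * W ω) ∂μ ≤
      ENNReal.ofReal d * ∫⁻ ω, ENNReal.ofReal (Z ω) ∂μ := by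
    calc ∫⁻ ω, ENNReal.ofReal (Z ω * W ω) ∂μ
        = ∫⁻ ω, ENNReal.ofReal (Z ω) ∂μ.withDensity fun ω => ENNReal.ofReal (W ω) := by
          rw [lintegral_withDensity_eq_lintegral_mul _ hWm.ennreal_ofReal hZm.ennreal_ofReal]
          refine lintegral_congr fun ω => ?_
          rw [Pi.mul_apply, ENNReal.ofReal_mul (hZ0 ω), mul_comm]
      _ = ∫⁻ ω, ENNReal.ofReal (Z ω) ∂(μ.withDensity fun ω => ENNReal.ofReal (W ω)).trim hm :=
          (lintegral_trim hm hZ.ennreal_ofReal).symm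
      _ ≤ ∫⁻ ω, ENNReal.ofReal (Z ω) ∂(ENNReal.ofReal d • μ.trim hm) :=
          lintegral_mono' hmeas le_rfl
      _ = _ := by
          rw [lintegral_smul_measure, lintegral_trim hm hZ.ennreal_ofReal, smul_eq_mul]
  rw [← ofReal_integral_eq_lintegral_ofReal hZi (ae_of_all _ hZ0), ← ENNReal.ofReal_mul hd0] at key
  rw [integral_eq_lintegral_of_nonneg_ae (ae_of_all _ fun ω => mul_nonneg (hZ0 ω) (hW0 ω))
    (hZm.mul hWm).aestronglyMeasurable, mul_comm _ d]
  exact ENNReal.toReal_le_of_le_ofReal (mul_nonneg hd0 (integral_nonneg hZ0)) key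

lemma integral_mul_le_two_mul_phiCoef [IsProbabilityMeasure μ] (hX : ∀ i, Measurable (X i))
    {Y : ℕ → Ω → ℝ}
    (hY : ∀ i, Measurable[MeasurableSpace.comap (X i) inferInstance] (Y i))
    (hb : ∀ i ω, |Y i ω| ≤ 1) (h0 : ∀ i, 1 ≤ i → ∫ ω, Y i ω ∂μ = 0) {i n : ℕ} (hi : 1 ≤ i) :
    ∫ ω, Y i ω * Y (i + n) ω ∂μ ≤ 2 * phiCoef X μ n := by
  have hYm : ∀ i, Measurable (Y i) := fun i => (hY i).mono (hX i).comap_le le_rfl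
  have hYi : ∀ i, Integrable (Y i) μ := fun i =>
    Integrable.of_bound (hYm i).aestronglyMeasurable 1 (ae_of_all _ (hb i))
  have hYY : Integrable (fun ω => Y i ω * Y (i + n) ω) μ :=
    (hYi _).bdd_mul (hYm i).aestronglyMeasurable (ae_of_all _ (hb i))
  have hmem : i ∈ {j | 1 ≤ j ∧ j ≤ i} := ⟨hi, le_rfl⟩
  have hmem' : i + n ∈ {j | i + n ≤ j} := le_refl (i + n)
  have key := integral_mul_le_phiCoef (μ := μ) hX (k := i) (n := n) (b := 2) (c := 2)
    (Z := fun ω => Y i ω + 1) (W := fun ω => Y (i + n) ω + 1)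
    (((hY i).mono (comap_le_sigmaGen hmem) le_rfl).add measurable_const)
    (fun ω => by linarith [(abs_le.1 (hb i ω)).1]) (fun ω => by linarith [(abs_le.1 (hb i ω)).2])
    (((hY _).mono (comap_le_sigmaGen hmem') le_rfl).add measurable_const)
    (fun ω => by linarith [(abs_le.1 (hb (i + n) ω)).1])
    (fun ω => by linarith [(abs_le.1 (hb (i + n) ω)).2])
  have hexp : ∫ ω, (Y i ω + 1) * (Y (i + n) ω + 1) ∂μ =
      ∫ ω, Y i ω * Y (i + n) ω ∂μ + 1 := by
    have : ∀ ω, (Y i ω + 1) * (Y (i + n) ω + 1) =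
        Y i ω * Y (i + n) ω + (Y i ω + (Y (i + n) ω + 1)) := fun ω => by ring
    simp_rw [this]
    rw [integral_add hYY ((hYi _).fun_add ((hYi _).fun_add (integrable_const _))),
      integral_add (hYi _) ((hYi _).fun_add (integrable_const _)),
      integral_add (hYi _) (integrable_const _), h0 i hi, h0 _ (by omega)]
    simp
  rw [hexp, integral_add (hYi _) (integrable_const _), integral_add (hYi _) (integrable_const _),
    h0 i hi, h0 _ (by omega)] at key
  simp at key
  linarith

lemma sum_phiCoef_le [IsProbabilityMeasure μ]
    (hsum : Summable fun n : ℕ => Real.sqrt (phiCoef X μ (n + 1))) (m : ℕ) :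
    ∑ d ∈ Finset.range m, Real.sqrt (phiCoef X μ (d + 1)) ≤
      ∑' n : ℕ, Real.sqrt (phiCoef X μ (n + 1)) :=
  hsum.sum_le_tsum _ fun _ _ => Real.sqrt_nonneg _

lemma integral_sq_block_sum_le [IsProbabilityMeasure μ] (hX : ∀ i, Measurable (X i))
    (hsum : Summable fun n : ℕ => Real.sqrt (phiCoef X μ (n + 1))) {Y : ℕ → Ω → ℝ}
    (hY : ∀ i, Measurable[MeasurableSpace.comap (X i) inferInstance] (Y i))
    (hb : ∀ i ω, |Y i ω| ≤ 1) (h0 : ∀ i, 1 ≤ i → ∫ ω, Y i ω ∂μ = 0) {a : ℕ} (ha : 1 ≤ a)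
    (m : ℕ) :
    ∫ ω, (∑ i ∈ Finset.range m, Y (a + i) ω) ^ 2 ∂μ ≤
      m * (1 + 4 * ∑' n : ℕ, Real.sqrt (phiCoef X μ (n + 1))) := by
  have hYm : ∀ i, Measurable (Y i) := fun i => (hY i).mono (hX i).comap_le le_rfl
  have hYi : ∀ i, Integrable (Y i) μ := fun i =>
    Integrable.of_bound (hYm i).aestronglyMeasurable 1 (ae_of_all _ (hb i))
  have hYY : ∀ i j, Integrable (fun ω => Y i ω * Y j ω) μ := fun i j =>
    (hYi _).bdd_mul (hYm i).aestronglyMeasurable (ae_of_all _ (hb i))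
  induction m with
  | zero => simp
  | succ m ih =>
    have hBm : Measurable fun ω => ∑ i ∈ Finset.range m, Y (a + i) ω :=
      Finset.measurable_fun_sum _ fun i _ => hYm _
    have hB2 : Integrable (fun ω => (∑ i ∈ Finset.range m, Y (a + i) ω) ^ 2) μ := by
      refine Integrable.of_bound (hBm.pow_const 2).aestronglyMeasurable ((m : ℝ) ^ 2)
        (ae_of_all _ fun ω => ?_)
      rw [Real.norm_eq_abs, abs_pow]
      exact pow_le_pow_left₀ (abs_nonneg _) (abs_block_sum_le hb a m ω) 2
    have hcross : Integrable
        (fun ω => 2 * ∑ i ∈ Finset.range m, Y (a + i) ω * Y (a + m) ω) μ :=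
      (integrable_finsetSum _ fun i _ => hYY _ _).const_mul 2
    have hsq : ∫ ω, Y (a + m) ω * Y (a + m) ω ∂μ ≤ 1 := by
      have : ∫ ω, Y (a + m) ω * Y (a + m) ω ∂μ ≤ ∫ _, (1 : ℝ) ∂μ :=
        integral_mono (hYY _ _) (integrable_const _) fun ω => by
          have := (sq_le_one_iff_abs_le_one (Y (a + m) ω)).2 (hb _ _)
          simpa [sq] using this
      simpa using this
    have hcov : ∑ i ∈ Finset.range m, ∫ ω, Y (a + i) ω * Y (a + m) ω ∂μ ≤
        2 * ∑' n : ℕ, Real.sqrt (phiCoef X μ (n + 1)) := by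
      calc ∑ i ∈ Finset.range m, ∫ ω, Y (a + i) ω * Y (a + m) ω ∂μ
          ≤ ∑ i ∈ Finset.range m, 2 * Real.sqrt (phiCoef X μ (m - 1 - i + 1)) := by
            refine Finset.sum_le_sum fun i hi => ?_
            have hi' := Finset.mem_range.1 hi
            have := integral_mul_le_two_mul_phiCoef (μ := μ) hX hY hb h0 (i := a + i)
              (n := m - 1 - i + 1) (by omega)
            rw [show a + i + (m - 1 - i + 1) = a + m by omega] at this
            linarith [phiCoef_le_sqrt (X := X) (μ := μ) (m - 1 - i + 1)]
        _ = 2 * ∑ d ∈ Finset.range m, Real.sqrt (phiCoef X μ (d + 1)) := by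
            rw [← Finset.mul_sum,
              Finset.sum_range_reflect (fun d => Real.sqrt (phiCoef X μ (d + 1)))]
        _ ≤ _ := by linarith [sum_phiCoef_le (X := X) (μ := μ) hsum m]
    have hexp : ∀ ω, (∑ i ∈ Finset.range (m + 1), Y (a + i) ω) ^ 2 =
        (∑ i ∈ Finset.range m, Y (a + i) ω) ^ 2 +
          (2 * ∑ i ∈ Finset.range m, Y (a + i) ω * Y (a + m) ω + Y (a + m) ω * Y (a + m) ω) :=
      fun ω => by rw [Finset.sum_range_succ, ← Finset.sum_mul]; ring
    simp_rw [hexp]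
    rw [integral_add hB2 (hcross.fun_add (hYY _ _)), integral_add hcross (hYY _ _),
      integral_const_mul, integral_finsetSum _ fun i _ => hYY _ _]
    push_cast
    linarith

lemma integral_exp_block_sum_le [IsProbabilityMeasure μ] (hX : ∀ i, Measurable (X i))
    (hsum : Summable fun n : ℕ => Real.sqrt (phiCoef X μ (n + 1))) {Y : ℕ → Ω → ℝ}
    (hY : ∀ i, Measurable[MeasurableSpace.comap (X i) inferInstance] (Y i))
    (hb : ∀ i ω, |Y i ω| ≤ 1) (h0 : ∀ i, 1 ≤ i → ∫ ω, Y i ω ∂μ = 0) {a : ℕ} (ha : 1 ≤ a)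
    {m : ℕ} {s : ℝ} (hs : 0 ≤ s) (hsm : s * m ≤ 1) :
    ∫ ω, Real.exp (s * ∑ i ∈ Finset.range m, Y (a + i) ω) ∂μ ≤
      1 + s ^ 2 * (m * (1 + 4 * ∑' n : ℕ, Real.sqrt (phiCoef X μ (n + 1)))) := by
  have hYm : ∀ i, Measurable (Y i) := fun i => (hY i).mono (hX i).comap_le le_rfl
  have hYi : ∀ i, Integrable (Y i) μ := fun i =>
    Integrable.of_bound (hYm i).aestronglyMeasurable 1 (ae_of_all _ (hb i))
  have hBm : Measurable fun ω => ∑ i ∈ Finset.range m, Y (a + i) ω :=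
    Finset.measurable_fun_sum _ fun i _ => hYm _
  have hBi : Integrable (fun ω => ∑ i ∈ Finset.range m, Y (a + i) ω) μ :=
    integrable_finsetSum _ fun i _ => hYi _
  have hB2 : Integrable (fun ω => (∑ i ∈ Finset.range m, Y (a + i) ω) ^ 2) μ := by
    refine Integrable.of_bound (hBm.pow_const 2).aestronglyMeasurable ((m : ℝ) ^ 2)
      (ae_of_all _ fun ω => ?_)
    rw [Real.norm_eq_abs, abs_pow]
    exact pow_le_pow_left₀ (abs_nonneg _) (abs_block_sum_le hb a m ω) 2
  have hBsm : ∀ ω, |s * ∑ i ∈ Finset.range m, Y (a + i) ω| ≤ 1 := fun ω => by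
    rw [abs_mul, abs_of_nonneg hs]
    exact (mul_le_mul_of_nonneg_left (abs_block_sum_le hb a m ω) hs).trans hsm
  have hB0 : ∫ ω, ∑ i ∈ Finset.range m, Y (a + i) ω ∂μ = 0 := by
    rw [integral_finsetSum _ fun i _ => hYi _]
    exact Finset.sum_eq_zero fun i _ => h0 _ (by omega)
  have hEi : Integrable (fun ω => Real.exp (s * ∑ i ∈ Finset.range m, Y (a + i) ω)) μ := by
    refine Integrable.of_bound (by fun_prop) (Real.exp 1) (ae_of_all _ fun ω => ?_)
    rw [Real.norm_of_nonneg (Real.exp_pos _).le]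
    exact Real.exp_le_exp.2 (abs_le.1 (hBsm ω)).2
  calc ∫ ω, Real.exp (s * ∑ i ∈ Finset.range m, Y (a + i) ω) ∂μ
      ≤ ∫ ω, (1 + (s * (∑ i ∈ Finset.range m, Y (a + i) ω) +
          s ^ 2 * (∑ i ∈ Finset.range m, Y (a + i) ω) ^ 2)) ∂μ := by
        refine integral_mono hEi
          ((integrable_const _).fun_add ((hBi.const_mul s).fun_add (hB2.const_mul _))) fun ω => ?_
        have := (abs_le.1 (Real.abs_exp_sub_one_sub_id_le (hBsm ω))).2
        dsimp only
        rw [← mul_pow]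
        linarith
    _ = 1 + s ^ 2 * ∫ ω, (∑ i ∈ Finset.range m, Y (a + i) ω) ^ 2 ∂μ := by
        rw [integral_add (integrable_const _) ((hBi.const_mul s).fun_add (hB2.const_mul _)),
          integral_add (hBi.const_mul s) (hB2.const_mul _), integral_const_mul,
          integral_const_mul, hB0]
        simp
    _ ≤ _ := by
        gcongr
        exact integral_sq_block_sum_le hX hsum hY hb h0 ha m

lemma integral_exp_sum_spaced_blocks_le [IsProbabilityMeasure μ] (hX : ∀ i, Measurable (X i))
    (hsum : Summable fun n : ℕ => Real.sqrt (phiCoef X μ (n + 1))) {Y : ℕ → Ω → ℝ}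
    (hY : ∀ i, Measurable[MeasurableSpace.comap (X i) inferInstance] (Y i))
    (hb : ∀ i ω, |Y i ω| ≤ 1) (h0 : ∀ i, 1 ≤ i → ∫ ω, Y i ω ∂μ = 0) {a : ℕ} (ha : 1 ≤ a)
    {m : ℕ} {s : ℝ} (hs : 0 ≤ s) (hsm : s * m ≤ 1) (K : ℕ) :
    ∫ ω, Real.exp (s * ∑ j ∈ Finset.range K,
        ∑ i ∈ Finset.range m, Y (a + 2 * m * j + i) ω) ∂μ ≤
      Real.exp (K * (s ^ 2 * (m * (1 + 4 * ∑' n : ℕ, Real.sqrt (phiCoef X μ (n + 1)))) +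
        3 * phiCoef X μ m)) := by
  induction K with
  | zero => simp
  | succ K ih =>
    set v : ℝ := 1 + 4 * ∑' n : ℕ, Real.sqrt (phiCoef X μ (n + 1)) with hv
    have hφ := phiCoef_nonneg (X := X) (μ := μ) m
    have hblock := integral_exp_block_sum_le (μ := μ) hX hsum hY hb h0
      (a := a + 2 * m * K) (by omega) hs hsm
    have hW0 : ∀ ω, 0 ≤ Real.exp (s * ∑ i ∈ Finset.range m, Y (a + 2 * m * K + i) ω) :=
      fun ω => (Real.exp_pos _).le
    have hW3 : ∀ ω, Real.exp (s * ∑ i ∈ Finset.range m, Y (a + 2 * m * K + i) ω) ≤ 3 := fun ω => by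
      refine le_trans (Real.exp_le_exp.2 (le_trans (mul_le_mul_of_nonneg_left
        (le_of_abs_le (abs_block_sum_le hb _ m ω)) hs) hsm)) ?_
      linarith [Real.exp_one_lt_d9]
    have hstep : ∫ ω, Real.exp (s * ∑ j ∈ Finset.range K,
          ∑ i ∈ Finset.range m, Y (a + 2 * m * j + i) ω) *
        Real.exp (s * ∑ i ∈ Finset.range m, Y (a + 2 * m * K + i) ω) ∂μ ≤
        (∫ ω, Real.exp (s * ∑ j ∈ Finset.range K,
          ∑ i ∈ Finset.range m, Y (a + 2 * m * j + i) ω) ∂μ) *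
        (∫ ω, Real.exp (s * ∑ i ∈ Finset.range m, Y (a + 2 * m * K + i) ω) ∂μ +
          3 * phiCoef X μ m) := by
      rcases Nat.eq_zero_or_pos K with rfl | hK
      · simpa using hφ
      · have h2 : 2 * m * K = 2 * m * (K - 1) + 2 * m := by
          obtain ⟨L, rfl⟩ : ∃ L, K = L + 1 := ⟨K - 1, by omega⟩
          simp; ring
        refine integral_mul_le_phiCoef hX (k := a + 2 * m * (K - 1) + m)
          (c := Real.exp (s * ∑ j ∈ Finset.range K, (m : ℝ)))
          ?_ (fun ω => (Real.exp_pos _).le) (fun ω => ?_) ?_ hW0 hW3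
        · refine Real.measurable_exp.comp (Measurable.const_mul
            (Finset.measurable_fun_sum _ fun j hj => measurable_block_sum hY fun i hi => ?_) _)
          have hj' : j ≤ K - 1 := by have := Finset.mem_range.1 hj; omega
          have := Nat.mul_le_mul_left (2 * m) hj'
          exact ⟨by omega, by omega⟩
        · refine Real.exp_le_exp.2 (mul_le_mul_of_nonneg_left
            (Finset.sum_le_sum fun j _ => le_of_abs_le (abs_block_sum_le hb _ m ω)) hs)
        · refine Real.measurable_exp.comp (Measurable.const_mul
            (measurable_block_sum hY fun i hi => ?_) _)
          show a + 2 * m * (K - 1) + m + m ≤ a + 2 * m * K + i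
          omega
    calc ∫ ω, Real.exp (s * ∑ j ∈ Finset.range (K + 1),
          ∑ i ∈ Finset.range m, Y (a + 2 * m * j + i) ω) ∂μ
        = ∫ ω, Real.exp (s * ∑ j ∈ Finset.range K,
            ∑ i ∈ Finset.range m, Y (a + 2 * m * j + i) ω) *
          Real.exp (s * ∑ i ∈ Finset.range m, Y (a + 2 * m * K + i) ω) ∂μ := by
          simp_rw [Finset.sum_range_succ _ K, mul_add, Real.exp_add]
      _ ≤ _ := hstep
      _ ≤ Real.exp (K * (s ^ 2 * (m * v) + 3 * phiCoef X μ m)) *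
          Real.exp (s ^ 2 * (m * v) + 3 * phiCoef X μ m) := by
          refine mul_le_mul ih ?_ ?_ (Real.exp_pos _).le
          · linarith [Real.add_one_le_exp (s ^ 2 * (m * v) + 3 * phiCoef X μ m)]
          · exact add_nonneg (integral_nonneg hW0) (by positivity)
      _ = _ := by
          rw [← Real.exp_add]; push_cast; congr 1; ring

lemma measureReal_sum_ge_le [IsProbabilityMeasure μ] (hX : ∀ i, Measurable (X i))
    (hsum : Summable fun n : ℕ => Real.sqrt (phiCoef X μ (n + 1))) {Y : ℕ → Ω → ℝ}
    (hY : ∀ i, Measurable[MeasurableSpace.comap (X i) inferInstance] (Y i))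
    (hb : ∀ i ω, |Y i ω| ≤ 1) (h0 : ∀ i, 1 ≤ i → ∫ ω, Y i ω ∂μ = 0)
    {m : ℕ} {s : ℝ} (hs : 0 ≤ s) (hsm : s * m ≤ 1) (K : ℕ) (u : ℝ) :
    μ.real {ω | u ≤ ∑ i ∈ Finset.range (2 * m * K), Y (1 + i) ω} ≤
      Real.exp (-(s / 2 * u) +
        K * (s ^ 2 * (m * (1 + 4 * ∑' n : ℕ, Real.sqrt (phiCoef X μ (n + 1)))) +
        3 * phiCoef X μ m)) := by
  have hYm : ∀ i, Measurable (Y i) := fun i => (hY i).mono (hX i).comap_le le_rfl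
  set R : ℝ := K * (s ^ 2 * (m * (1 + 4 * ∑' n : ℕ, Real.sqrt (phiCoef X μ (n + 1)))) +
        3 * phiCoef X μ m) with hR
  have hmgf : ∀ a, 1 ≤ a → ∫ ω, Real.exp (s * ∑ j ∈ Finset.range K,
      ∑ i ∈ Finset.range m, Y (a + 2 * m * j + i) ω) ∂μ ≤ Real.exp R := fun a ha =>
    integral_exp_sum_spaced_blocks_le hX hsum hY hb h0 ha hs hsm K
  have hint : ∀ a, Integrable (fun ω => Real.exp (s * ∑ j ∈ Finset.range K,
      ∑ i ∈ Finset.range m, Y (a + 2 * m * j + i) ω)) μ := fun a => by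
    refine Integrable.of_bound (by fun_prop) (Real.exp (s * ∑ j ∈ Finset.range K, (m : ℝ)))
      (ae_of_all _ fun ω => ?_)
    rw [Real.norm_of_nonneg (Real.exp_pos _).le]
    exact Real.exp_le_exp.2 (mul_le_mul_of_nonneg_left
      (Finset.sum_le_sum fun j _ => le_of_abs_le (abs_block_sum_le hb _ m ω)) hs)
  have hpt : ∀ ω, Real.exp (s / 2 * ∑ i ∈ Finset.range (2 * m * K), Y (1 + i) ω) ≤
      2⁻¹ * (Real.exp (s * ∑ j ∈ Finset.range K, ∑ i ∈ Finset.range m, Y (1 + 2 * m * j + i) ω) +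
        Real.exp (s * ∑ j ∈ Finset.range K,
          ∑ i ∈ Finset.range m, Y ((1 + m) + 2 * m * j + i) ω)) := fun ω => by
    have hsplit := sum_range_two_mul_blocks (fun i => Y (1 + i) ω) m K
    simp only [← add_assoc] at hsplit
    rw [hsplit]
    generalize ∑ j ∈ Finset.range K, ∑ i ∈ Finset.range m, Y (1 + 2 * m * j + i) ω = x
    generalize ∑ j ∈ Finset.range K, ∑ i ∈ Finset.range m, Y (1 + m + 2 * m * j + i) ω = y
    have e : ∀ z, Real.exp (s * z) = Real.exp (s / 2 * z) ^ 2 := fun z => by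
      rw [← Real.exp_nat_mul]; congr 1; push_cast; ring
    rw [e x, e y, mul_add, Real.exp_add]
    nlinarith [sq_nonneg (Real.exp (s / 2 * x) - Real.exp (s / 2 * y))]
  have hSint : Integrable
      (fun ω => Real.exp (s / 2 * ∑ i ∈ Finset.range (2 * m * K), Y (1 + i) ω)) μ :=
    (((hint 1).fun_add (hint (1 + m))).const_mul 2⁻¹).mono' (by fun_prop)
      (ae_of_all _ fun ω => by rw [Real.norm_of_nonneg (Real.exp_pos _).le]; exact hpt ω)
  have hS : ∫ ω, Real.exp (s / 2 * ∑ i ∈ Finset.range (2 * m * K), Y (1 + i) ω) ∂μ ≤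
      Real.exp R := by
    refine (integral_mono hSint (((hint 1).fun_add (hint (1 + m))).const_mul 2⁻¹) hpt).trans ?_
    rw [integral_const_mul, integral_add (hint 1) (hint (1 + m))]
    linarith [hmgf 1 le_rfl, hmgf (1 + m) (by omega)]
  have hmarkov := mul_meas_ge_le_integral_of_nonneg (ae_of_all _ fun ω => (Real.exp_pos _).le)
    hSint (Real.exp (s / 2 * u))
  have hsub : μ.real {ω | u ≤ ∑ i ∈ Finset.range (2 * m * K), Y (1 + i) ω} ≤
      μ.real {ω | Real.exp (s / 2 * u) ≤
        Real.exp (s / 2 * ∑ i ∈ Finset.range (2 * m * K), Y (1 + i) ω)} :=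
    measureReal_mono fun ω (hω : u ≤ _) =>
      Real.exp_le_exp.2 (mul_le_mul_of_nonneg_left hω (by positivity))
  rw [Real.exp_add, Real.exp_neg, inv_mul_eq_div, le_div_iff₀ (Real.exp_pos _)]
  nlinarith [Real.exp_pos (s / 2 * u)]

lemma sq_mul_phiCoef_le [IsProbabilityMeasure μ] (hanti : Antitone (phiCoef X μ))
    (hsum : Summable fun n : ℕ => Real.sqrt (phiCoef X μ (n + 1))) (m : ℕ) :
    (m : ℝ) ^ 2 * phiCoef X μ m ≤ (∑' n : ℕ, Real.sqrt (phiCoef X μ (n + 1))) ^ 2 := by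
  have h : m * Real.sqrt (phiCoef X μ m) ≤ ∑' n : ℕ, Real.sqrt (phiCoef X μ (n + 1)) := by
    refine le_trans ?_ (sum_phiCoef_le hsum m)
    have hcard := Finset.card_nsmul_le_sum (Finset.range m)
      (fun d => Real.sqrt (phiCoef X μ (d + 1))) (Real.sqrt (phiCoef X μ m))
      fun d hd => Real.sqrt_le_sqrt (hanti (Finset.mem_range.1 hd))
    simpa using hcard
  calc (m : ℝ) ^ 2 * phiCoef X μ m = (m * Real.sqrt (phiCoef X μ m)) ^ 2 := by
        rw [mul_pow, Real.sq_sqrt (phiCoef_nonneg m)]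
    _ ≤ _ := pow_le_pow_left₀ (by positivity) h 2

lemma exists_measureReal_sum_ge_le [IsProbabilityMeasure μ] (hX : ∀ i, Measurable (X i))
    (hanti : Antitone (phiCoef X μ))
    (hsum : Summable fun n : ℕ => Real.sqrt (phiCoef X μ (n + 1))) :
    ∃ C : ℝ, ∀ᶠ n : ℕ in atTop, ∀ Y : ℕ → Ω → ℝ,
      (∀ i, Measurable[MeasurableSpace.comap (X i) inferInstance] (Y i)) →
      (∀ i ω, |Y i ω| ≤ 1) → (∀ i, 1 ≤ i → ∫ ω, Y i ω ∂μ = 0) →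
      μ.real {ω | 4 * Real.sqrt (1 + 4 * ∑' n : ℕ, Real.sqrt (phiCoef X μ (n + 1))) *
        (n * Real.sqrt (Real.log n / n)) ≤ ∑ i ∈ Finset.Icc 1 n, Y i ω} ≤
        C * ((n : ℝ) ^ 2)⁻¹ := by
  set T : ℝ := ∑' n : ℕ, Real.sqrt (phiCoef X μ (n + 1)) with hT
  have hT0 : 0 ≤ T := tsum_nonneg fun _ => Real.sqrt_nonneg _
  set v : ℝ := 1 + 4 * T with hv
  have hv1 : 1 ≤ v := by linarith
  refine ⟨Real.exp (1 + 5 * T ^ 2), ?_⟩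
  filter_upwards [eventually_ge_atTop 1, eventually_exists_block_length] with n hn1 hm Y hY hb h0
  obtain ⟨m, hm1, hm3, hmlog⟩ := hm
  have hn : (1 : ℝ) ≤ n := by exact_mod_cast hn1
  have hmR : (1 : ℝ) ≤ m := by exact_mod_cast hm1
  have hm3R : (n : ℝ) ≤ (m : ℝ) ^ 3 := by exact_mod_cast hm3
  have hlog : 0 ≤ Real.log n := Real.log_nonneg hn
  set s : ℝ := 2 * Real.sqrt (Real.log n / (n * v)) with hs
  have hs2 : s ^ 2 = 4 * Real.log n / (n * v) := by
    rw [hs, mul_pow, Real.sq_sqrt (by positivity)]; ring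
  have hs0 : 0 ≤ s := by positivity
  have hsm : s * m ≤ 1 := by
    refine (sq_le_one_iff₀ (by positivity)).1 ?_
    rw [mul_pow, hs2, div_mul_eq_mul_div, div_le_one (by positivity)]
    nlinarith
  set K : ℕ := n / (2 * m) + 1 with hK
  have hnK : n ≤ 2 * m * K := by
    have := Nat.lt_mul_div_succ n (show 0 < 2 * m by omega)
    exact this.le
  have hKR : (K : ℝ) ≤ n / (2 * m) + 1 := by
    rw [hK]; push_cast
    have : ((n / (2 * m) : ℕ) : ℝ) ≤ (n : ℝ) / ((2 * m : ℕ) : ℝ) := Nat.cast_div_le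
    push_cast at this
    linarith
  set Y' : ℕ → Ω → ℝ := fun i ω => if i ≤ n then Y i ω else 0 with hY'
  have hsumY : ∀ ω, ∑ i ∈ Finset.range (2 * m * K), Y' (1 + i) ω = ∑ i ∈ Finset.Icc 1 n, Y i ω :=
    fun ω => by
      have h1 : ∑ i ∈ Finset.Icc 1 n, Y i ω = ∑ i ∈ Finset.range n, Y' (1 + i) ω := by
        rw [← Finset.Ico_add_one_right_eq_Icc, Finset.sum_Ico_eq_sum_range]
        refine Finset.sum_congr (by simp) fun i hi => ?_
        have := Finset.mem_range.1 hi
        simp only [hY']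
        rw [if_pos (by omega)]
      rw [h1]
      refine (Finset.sum_subset (Finset.range_mono hnK) fun i _ hi => ?_).symm
      simp only [Finset.mem_range] at hi
      simp only [hY']
      rw [if_neg (by omega)]
  have htail := measureReal_sum_ge_le (μ := μ) hX hsum (Y := Y')
    (fun i => by
      by_cases hi : i ≤ n
      · simpa [hY', hi] using hY i
      · simp [hY', hi])
    (fun i ω => by
      by_cases hi : i ≤ n
      · simpa [hY', hi] using hb i ω
      · simp [hY', hi])
    (fun i h1 => by
      by_cases hi : i ≤ n
      · simpa [hY', hi] using h0 i h1
      · simp [hY', hi])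
    hs0 hsm K (4 * Real.sqrt v * (n * Real.sqrt (Real.log n / n)))
  simp_rw [hsumY] at htail
  refine htail.trans ?_
  have hsu : s / 2 * (4 * Real.sqrt v * (n * Real.sqrt (Real.log n / n))) = 4 * Real.log n := by
    have hmul : Real.sqrt (Real.log n / (n * v)) * Real.sqrt v = Real.sqrt (Real.log n / n) := by
      rw [← Real.sqrt_mul (by positivity)]
      congr 1
      field_simp
    calc s / 2 * (4 * Real.sqrt v * (n * Real.sqrt (Real.log n / n)))
        = 4 * n * ((Real.sqrt (Real.log n / (n * v)) * Real.sqrt v) *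
          Real.sqrt (Real.log n / n)) := by rw [hs]; ring
      _ = 4 * Real.log n := by
        rw [hmul, Real.mul_self_sqrt (by positivity)]
        field_simp
  have hvar : K * (s ^ 2 * (m * v)) ≤ 2 * Real.log n + 1 := by
    have hKm : (K : ℝ) * m ≤ n / 2 + m := by
      calc (K : ℝ) * m ≤ (n / (2 * m) + 1) * m := by gcongr
        _ = n / 2 + m := by field_simp
    calc K * (s ^ 2 * (m * v)) = (K * m) * (4 * Real.log n / n) := by
          rw [hs2]; field_simp
      _ ≤ (n / 2 + m) * (4 * Real.log n / n) := by gcongr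
      _ = 2 * Real.log n + 4 * m * Real.log n / n := by field_simp; ring
      _ ≤ 2 * Real.log n + 1 := by
          gcongr
          rw [div_le_one (by positivity)]
          nlinarith [mul_nonneg hlog (mul_nonneg (by positivity : (0 : ℝ) ≤ m) (sub_nonneg.2 hmR))]
  have hmix : K * (3 * phiCoef X μ m) ≤ 5 * T ^ 2 := by
    have hφ := phiCoef_nonneg (X := X) (μ := μ) m
    have hK2 : (K : ℝ) ≤ 3 / 2 * (m : ℝ) ^ 2 := by
      refine hKR.trans ?_
      have : (n : ℝ) / (2 * m) ≤ (m : ℝ) ^ 2 / 2 := by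
        rw [div_le_div_iff₀ (by positivity) (by positivity)]
        nlinarith
      nlinarith
    have hsq := sq_mul_phiCoef_le (μ := μ) hanti hsum m
    nlinarith [mul_le_mul_of_nonneg_right hK2 hφ]
  rw [hsu]
  have hn2 : ((n : ℝ) ^ 2)⁻¹ = Real.exp (-(2 * Real.log n)) := by
    rw [Real.exp_neg, two_mul, Real.exp_add, Real.exp_log (by positivity), sq]
  rw [hn2, ← Real.exp_add]
  refine Real.exp_le_exp.2 ?_
  linarith [mul_add (K : ℝ) (s ^ 2 * (m * v)) (3 * phiCoef X μ m)]

end PhiMixing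

lemma ae_eventually_notMem_of_summable {Ω : Type*} [MeasurableSpace Ω] {μ : Measure Ω}
    [IsFiniteMeasure μ] {s : ℕ → Set Ω} {a : ℕ → ℝ} (ha : Summable a)
    (h : ∀ᶠ n in atTop, μ.real (s n) ≤ a n) : ∀ᵐ ω ∂μ, ∀ᶠ n in atTop, ω ∉ s n := by
  refine ae_eventually_notMem ?_
  have hs : Summable fun n => μ.real (s n) :=
    Summable.of_norm_bounded_eventually_nat ha
      (h.mono fun n hn => by rwa [Real.norm_of_nonneg measureReal_nonneg])
  simpa using hs.tsum_ofReal_ne_top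

lemma apply_quantile_of_continuousAt {F : ℝ → ℝ} {p : ℝ} (hmono : Monotone F)
    (hbot : Tendsto F atBot (nhds 0)) (htop : Tendsto F atTop (nhds 1)) (hp : 0 < p ∧ p < 1)
    (hc : ContinuousAt F (quantile F p)) : F (quantile F p) = p := by
  have hne : {x : ℝ | p ≤ F x}.Nonempty := (htop.eventually (eventually_ge_nhds hp.2)).exists
  have hbdd : BddBelow {x : ℝ | p ≤ F x} := by
    obtain ⟨b, hb⟩ := (hbot.eventually (eventually_lt_nhds hp.1)).exists
    exact ⟨b, fun x hx => le_of_lt (hmono.reflect_lt (hb.trans_le hx))⟩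
  refine le_antisymm ?_ ?_
  · refine le_of_tendsto (hc.tendsto.mono_left (nhdsWithin_le_nhds (s := Iio (quantile F p)))) ?_
    filter_upwards [self_mem_nhdsWithin] with y hy
    by_contra! h
    exact absurd (csInf_le hbdd h.le) (not_le.2 hy)
  · refine ge_of_tendsto (hc.tendsto.mono_left (nhdsWithin_le_nhds (s := Ioi (quantile F p)))) ?_
    filter_upwards [self_mem_nhdsWithin] with y hy
    obtain ⟨z, hz, hzy⟩ := exists_lt_of_csInf_lt hne hy
    exact le_trans hz (hmono hzy.le)

section SampleQuantile

variable {Ω : Type*} {X : ℕ → Ω → ℝ} {n : ℕ} {ω : Ω} {p x : ℝ}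

lemma empDF_mono : Monotone (empDF X n ω) := fun x y hxy => by
  refine mul_le_mul_of_nonneg_left (Finset.sum_le_sum fun i _ => ?_) (by positivity)
  split_ifs with h1 h2
  · exact le_rfl
  · exact absurd (h1.trans hxy) h2
  · exact zero_le_one
  · exact le_rfl

lemma sampleQuantile_le (hp : 0 < p) (h : p ≤ empDF X n ω x) : sampleQuantile X n ω p ≤ x := by
  obtain ⟨b, hb⟩ := ((Finset.Icc 1 n).image fun i => X i ω).bddBelow
  refine csInf_le ⟨b, fun y hy => ?_⟩ h
  by_contra! hyb
  have hzero : empDF X n ω y = 0 := by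
    rw [empDF, Finset.sum_eq_zero, mul_zero]
    intro i hi
    refine if_neg fun hle => ?_
    have := hb (Finset.mem_coe.2 (Finset.mem_image_of_mem (fun i => X i ω) hi))
    linarith
  have : p ≤ empDF X n ω y := hy
  linarith

lemma le_sampleQuantile (hn : 1 ≤ n) (hp : p ≤ 1) (h : empDF X n ω x < p) :
    x ≤ sampleQuantile X n ω p := by
  obtain ⟨b, hb⟩ := ((Finset.Icc 1 n).image fun i => X i ω).bddAbove
  refine le_csInf ⟨b, ?_⟩ fun y hy => le_of_lt (empDF_mono.reflect_lt (h.trans_le hy))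
  have hone : empDF X n ω b = 1 := by
    have hn0 : (n : ℝ) ≠ 0 := by positivity
    rw [empDF, Finset.sum_congr rfl fun i hi =>
      if_pos (hb (Finset.mem_coe.2 (Finset.mem_image_of_mem (fun i => X i ω) hi)))]
    simp [hn0]
  simpa [hone] using hp

end SampleQuantile

lemma HasDerivAt.eventually_mul_le_sub_of_pos {F : ℝ → ℝ} {d x a b : ℝ} (hF : HasDerivAt F d x)
    (hd : 0 < d) (ha : 0 ≤ a) (hab : a < b) :
    ∀ᶠ r in nhds (0 : ℝ), 0 ≤ r →
      a * r ≤ F (x + b * r / d) - F x ∧ a * r ≤ F x - F (x - b * r / d) := by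
  have hb : 0 < b := ha.trans_lt hab
  have hc : 0 < d * (b - a) / b := div_pos (mul_pos hd (by linarith)) hb
  have hlo := (hasDerivAt_iff_isLittleO.1 hF).def hc
  have ht1 : Tendsto (fun r : ℝ => x + b * r / d) (nhds 0) (nhds x) := by
    have : Continuous fun r : ℝ => x + b * r / d := by fun_prop
    simpa using this.tendsto 0
  have ht2 : Tendsto (fun r : ℝ => x - b * r / d) (nhds 0) (nhds x) := by
    have : Continuous fun r : ℝ => x - b * r / d := by fun_prop
    simpa using this.tendsto 0
  filter_upwards [ht1.eventually hlo, ht2.eventually hlo] with r h1 h2 hr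
  have hbr : 0 ≤ b * r / d := by positivity
  have e1 : b * r / d * d = b * r := by field_simp
  have e2 : d * (b - a) / b * (b * r / d) = (b - a) * r := by field_simp
  simp only [add_sub_cancel_left, sub_sub_cancel_left, smul_eq_mul, Real.norm_eq_abs, abs_neg,
    abs_of_nonneg hbr, e2, neg_mul, e1] at h1 h2
  rw [abs_le] at h1 h2
  constructor <;> linarith [h1.1, h2.2]

lemma tendsto_sqrt_log_div_atTop :
    Tendsto (fun n : ℕ => Real.sqrt (Real.log n / n)) atTop (nhds 0) := by
  have h := (Real.isLittleO_log_id_atTop.tendsto_div_nhds_zero).comp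
    (tendsto_natCast_atTop_atTop (R := ℝ))
  simpa [Function.comp_def] using (Real.continuous_sqrt.tendsto 0).comp h

/-- **Lemma 3.3.** For a φ-mixing sequence with `∑ φ^{1/2}(n) < ∞`, if `F` is
differentiable at `ξ_p` with `F'(ξ_p) = f(ξ_p) > 0` and `f'` is bounded in some
neighborhood of `ξ_p`, then for any `δ > 0`, with probability 1,
`|ξ_{p,n} - ξ_p| ≤ (2√C₃ + δ)(log n)^{1/2} / (f(ξ_p) n^{1/2})` for all sufficiently
large `n`, where `C₃ = 4[1 + 4 ∑_{n=1}^∞ φ^{1/2}(n)]`. -/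
theorem bahadur_lem_3_3 {Ω : Type*} [MeasurableSpace Ω] (μ : Measure Ω)
    [IsProbabilityMeasure μ]
    (X : ℕ → Ω → ℝ) (hX : ∀ i, Measurable (X i))
    (hanti : Antitone (phiCoef X μ))
    (hmix : Tendsto (phiCoef X μ) atTop (nhds 0))
    (hsum : Summable fun n : ℕ => Real.sqrt (phiCoef X μ (n + 1)))
    (F : ℝ → ℝ) (hF : ∀ i, 1 ≤ i → ∀ x, F x = (μ {ω | X i ω ≤ x}).toReal)
    (p : ℝ) (hp : 0 < p ∧ p < 1)
    (f : ℝ → ℝ) (hFf : HasDerivAt F (f (quantile F p)) (quantile F p))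
    (hfpos : 0 < f (quantile F p))
    (Np : Set ℝ) (hNp : Np ∈ nhds (quantile F p))
    (f' : ℝ → ℝ) (hff' : ∀ x ∈ Np, HasDerivAt f (f' x) x)
    (hf'bdd : ∃ M : ℝ, ∀ x ∈ Np, |f' x| ≤ M)
    (C3 : ℝ) (hC3 : C3 = 4 * (1 + 4 * ∑' n : ℕ, Real.sqrt (phiCoef X μ (n + 1))))
    (δ : ℝ) (hδ : 0 < δ) :
    ∀ᵐ ω ∂μ, ∀ᶠ n : ℕ in atTop,
      |sampleQuantile X n ω p - quantile F p| ≤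
        (2 * Real.sqrt C3 + δ) * Real.log n ^ ((1 : ℝ) / 2) /
          (f (quantile F p) * (n : ℝ) ^ ((1 : ℝ) / 2)) := by
  have hF01 : ∀ x, 0 ≤ F x ∧ F x ≤ 1 := fun x => by
    rw [hF 1 le_rfl x]
    exact ⟨ENNReal.toReal_nonneg, measureReal_le_one⟩
  have hFcdf : F = ProbabilityTheory.cdf (μ.map (X 1)) := by
    have := Measure.isProbabilityMeasure_map (μ := μ) (hX 1).aemeasurable
    funext x
    rw [hF 1 le_rfl x, ProbabilityTheory.cdf_eq_real, map_measureReal_apply (hX 1) measurableSet_Iic]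
    rfl
  have hFp : F (quantile F p) = p := by
    refine apply_quantile_of_continuousAt ?_ ?_ ?_ hp hFf.continuousAt <;> rw [hFcdf]
    · exact ProbabilityTheory.monotone_cdf _
    · exact ProbabilityTheory.tendsto_cdf_atBot _
    · exact ProbabilityTheory.tendsto_cdf_atTop _
  set ξ := quantile F p with hξ
  set d := f ξ with hd
  set v : ℝ := 1 + 4 * ∑' n : ℕ, Real.sqrt (phiCoef X μ (n + 1)) with hv
  have hC3v : 2 * Real.sqrt C3 = 4 * Real.sqrt v := by
    rw [hC3, Real.sqrt_mul (by norm_num), show (4 : ℝ) = 2 ^ 2 by norm_num,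
      Real.sqrt_sq (by norm_num)]
    ring
  rw [hC3v]
  set r : ℕ → ℝ := fun n => Real.sqrt (Real.log n / n) with hr
  set ε : ℕ → ℝ := fun n => (4 * Real.sqrt v + δ) * r n / d with hε
  set D : ℝ → ℕ → Ω → ℝ := fun x i ω => F x - if X i ω ≤ x then 1 else 0 with hD
  have hDmeas : ∀ x i, Measurable[MeasurableSpace.comap (X i) inferInstance] (D x i) := fun x i =>
    Measurable.comp (g := fun y : ℝ => F x - if y ≤ x then (1 : ℝ) else 0)
      (measurable_const.sub (Measurable.ite measurableSet_Iic measurable_const measurable_const))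
      (comap_measurable (X i))
  have hDb : ∀ x i ω, |D x i ω| ≤ 1 := fun x i ω => by
    simp only [hD]
    rw [abs_le]
    split_ifs <;> constructor <;> linarith [(hF01 x).1, (hF01 x).2]
  have hD0 : ∀ x i, 1 ≤ i → ∫ ω, D x i ω ∂μ = 0 := fun x i hi => by
    have hm : MeasurableSet {ω | X i ω ≤ x} := hX i measurableSet_Iic
    have hind : (fun ω => if X i ω ≤ x then (1 : ℝ) else 0) =
        {ω | X i ω ≤ x}.indicator fun _ => 1 := by
      ext ω; simp [indicator_apply]
    simp only [hD]
    rw [integral_sub (integrable_const _) (by rw [hind]; exact (integrable_const _).indicator hm),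
      hind, integral_indicator_const _ hm, hF i hi x]
    simp [Measure.real]
  have hDsum : ∀ x n ω, 1 ≤ n → ∑ i ∈ Finset.Icc 1 n, D x i ω = n * (F x - empDF X n ω x) :=
    fun x n ω hn => by
      have hn0 : (n : ℝ) ≠ 0 := by positivity
      simp only [hD, empDF, Finset.sum_sub_distrib]
      rw [mul_sub, mul_inv_cancel_left₀ hn0]
      simp
  obtain ⟨C, hC⟩ := exists_measureReal_sum_ge_le (μ := μ) hX hanti hsum
  have hsumm : Summable fun n : ℕ => C * ((n : ℝ) ^ 2)⁻¹ :=
    (Real.summable_nat_pow_inv.2 one_lt_two).mul_left C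
  have hup : ∀ᵐ ω ∂μ, ∀ᶠ n : ℕ in atTop, ω ∉ {ω | 4 * Real.sqrt v * (n * r n) ≤
      ∑ i ∈ Finset.Icc 1 n, D (ξ + ε n) i ω} :=
    ae_eventually_notMem_of_summable hsumm <| hC.mono fun n hn =>
      hn _ (hDmeas _) (hDb _) (hD0 _)
  have hlow : ∀ᵐ ω ∂μ, ∀ᶠ n : ℕ in atTop, ω ∉ {ω | 4 * Real.sqrt v * (n * r n) ≤
      ∑ i ∈ Finset.Icc 1 n, -D (ξ - ε n) i ω} :=
    ae_eventually_notMem_of_summable hsumm <| hC.mono fun n hn =>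
      hn (fun i ω => -D (ξ - ε n) i ω) (fun i => (hDmeas _ i).neg)
        (fun i ω => by rw [abs_neg]; exact hDb _ i ω)
        (fun i hi => by rw [integral_neg, hD0 _ i hi, neg_zero])
  have hdet := tendsto_sqrt_log_div_atTop.eventually
    (hFf.eventually_mul_le_sub_of_pos hfpos (a := 4 * Real.sqrt v) (b := 4 * Real.sqrt v + δ)
      (by positivity) (by linarith))
  filter_upwards [hup, hlow] with ω hω1 hω2
  filter_upwards [hω1, hω2, hdet, eventually_ge_atTop 1] with n h1 h2 h3 hn
  have hn1 : (1 : ℝ) ≤ n := by exact_mod_cast hn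
  have hn0 : (0 : ℝ) < n := by linarith
  obtain ⟨h3a, h3b⟩ := h3 (Real.sqrt_nonneg _)
  simp only [not_le, Finset.sum_neg_distrib, hDsum _ n ω hn] at h1 h2
  have hgoal : (4 * Real.sqrt v + δ) * Real.log n ^ ((1 : ℝ) / 2) /
      (d * (n : ℝ) ^ ((1 : ℝ) / 2)) = ε n := by
    simp only [hε, hr]
    rw [← Real.sqrt_eq_rpow, ← Real.sqrt_eq_rpow, Real.sqrt_div (Real.log_nonneg hn1)]
    field_simp
  rw [hgoal, abs_sub_le_iff]
  constructor
  · have : p ≤ empDF X n ω (ξ + ε n) := by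
      have h4 : F (ξ + ε n) - empDF X n ω (ξ + ε n) < 4 * Real.sqrt v * r n := by
        refine lt_of_mul_lt_mul_left (a := (n : ℝ)) ?_ hn0.le
        linarith
      linarith
    linarith [sampleQuantile_le hp.1 this]
  · have : empDF X n ω (ξ - ε n) < p := by
      have h4 : -(F (ξ - ε n) - empDF X n ω (ξ - ε n)) < 4 * Real.sqrt v * r n := by
        refine lt_of_mul_lt_mul_left (a := (n : ℝ)) ?_ hn0.le
        linarith
      linarith
    linarith [le_sampleQuantile hn hp.2.le this]
end

section
/- Let G and F be nondecreasing real-valued functions on the real line, let ξ ∈ ℝ, a > 0, and let η_r = ξ + (a/b) r for integers r = −b, …, b, where b is a positive integer (so η_{−b} = ξ − a and η_b = ξ + a). Then sup_{x ∈ [ξ−a, ξ+a]} |(G(x) − F(x)) − (G(ξ) − F(ξ))| ≤ max_{−b ≤ r ≤ b} |(G(η_r) − F(η_r)) − (G(ξ) − F(ξ))| + max_{−b ≤ r ≤ b−1} (F(η_{r+1}) − F(η_r)). -/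
open MeasureTheory Filter Set

/-- For monotone `G` and `F`, the deviation of `G - F` from a constant at a point of `[u, v]` is
bounded by its deviation at the endpoints plus the increment of `F`. -/
theorem abs_sub_sub_le_of_monotone {G F : ℝ → ℝ} (hG : Monotone G) (hF : Monotone F)
    {u x v c M : ℝ} (hux : u ≤ x) (hxv : x ≤ v)
    (hu : |(G u - F u) - c| ≤ M) (hv : |(G v - F v) - c| ≤ M) :
    |(G x - F x) - c| ≤ M + (F v - F u) := by
  rw [abs_le] at *
  constructor <;> linarith [hG hux, hG hxv, hF hux, hF hxv]

/-- A point of `[-b, b]` lies between two consecutive integers of `[-b, b]`. -/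
theorem exists_int_mem_Icc_le_le_add_one {b : ℕ} (hb : 0 < b) {t : ℝ}
    (ht : t ∈ Set.Icc (-(b : ℝ)) b) :
    ∃ r ∈ Set.Icc (-(b : ℤ)) ((b : ℤ) - 1), (r : ℝ) ≤ t ∧ t ≤ r + 1 := by
  rcases ht.2.lt_or_eq with h | rfl
  · refine ⟨⌊t⌋, ⟨Int.le_floor.2 (by exact_mod_cast ht.1), ?_⟩, Int.floor_le t,
      (Int.lt_floor_add_one t).le⟩
    exact Int.le_sub_one_of_lt (Int.floor_lt.2 (by exact_mod_cast h))
  · exact ⟨(b : ℤ) - 1, ⟨by lia, le_rfl⟩, by simp, by simp⟩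

/-- **Chaining (discretization) inequality.** For nondecreasing `G, F : ℝ → ℝ`,
`ξ ∈ ℝ`, `a > 0`, a positive integer `b` and the grid `η_r = ξ + (a/b) r`,
`r = -b, …, b`, one has
`sup_{x ∈ [ξ-a, ξ+a]} |(G(x) - F(x)) - (G(ξ) - F(ξ))|
  ≤ max_{-b ≤ r ≤ b} |(G(η_r) - F(η_r)) - (G(ξ) - F(ξ))|
    + max_{-b ≤ r ≤ b-1} (F(η_{r+1}) - F(η_r))`. -/
theorem bahadur_chaining (G F : ℝ → ℝ) (hG : Monotone G) (hF : Monotone F)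
    (ξ a : ℝ) (ha : 0 < a) (b : ℕ) (hb : 0 < b)
    (η : ℤ → ℝ) (hη : ∀ r : ℤ, η r = ξ + a / b * r) :
    sSup ((fun x => |(G x - F x) - (G ξ - F ξ)|) '' Set.Icc (ξ - a) (ξ + a)) ≤
      sSup ((fun r : ℤ => |(G (η r) - F (η r)) - (G ξ - F ξ)|) ''
          Set.Icc (-(b : ℤ)) (b : ℤ)) +
        sSup ((fun r : ℤ => F (η (r + 1)) - F (η r)) ''
          Set.Icc (-(b : ℤ)) ((b : ℤ) - 1)) := by
  have hb' : (0 : ℝ) < b := Nat.cast_pos.2 hb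
  have hmono : ∀ {s t : ℝ}, s ≤ t → ξ + a / b * s ≤ ξ + a / b * t := fun h => by gcongr
  refine csSup_le ((Set.nonempty_Icc.2 (by linarith)).image _) ?_
  rintro _ ⟨x, ⟨hx₁, hx₂⟩, rfl⟩
  have hxt : ξ + a / b * ((x - ξ) * b / a) = x := by field_simp; ring
  obtain ⟨r, ⟨hr₁, hr₂⟩, hrt, htr⟩ := exists_int_mem_Icc_le_le_add_one hb
    (t := (x - ξ) * b / a)
    ⟨by rw [le_div_iff₀ ha]; nlinarith, by rw [div_le_iff₀ ha]; nlinarith⟩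
  have hux : η r ≤ x := by rw [hη, ← hxt]; exact hmono hrt
  have hxv : x ≤ η (r + 1) := by rw [hη, ← hxt]; push_cast; exact hmono htr
  have hgrid : ∀ k ∈ Set.Icc (-(b : ℤ)) (b : ℤ),
      |(G (η k) - F (η k)) - (G ξ - F ξ)| ≤
        sSup ((fun r : ℤ => |(G (η r) - F (η r)) - (G ξ - F ξ)|) ''
          Set.Icc (-(b : ℤ)) (b : ℤ)) := fun k hk =>
    le_csSup ((Set.finite_Icc _ _).image _).bddAbove ⟨k, hk, rfl⟩
  refine (abs_sub_sub_le_of_monotone hG hF hux hxv (hgrid r ⟨hr₁, by lia⟩)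
    (hgrid (r + 1) ⟨by lia, by lia⟩)).trans (add_le_add le_rfl ?_)
  exact le_csSup ((Set.finite_Icc _ _).image _).bddAbove ⟨r, ⟨hr₁, hr₂⟩, rfl⟩
end
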